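/- The tableau system TC_SCI is sound: if an SCI-formula φ is SCI-satisfiable, then φ is tableau-satisfiable, i.e., there exists an open and fully expanded TC_SCI-tableau with w⁺ : φ (w⁺ ∈ L⁺) at its root; equivalently, if there is a closed TC_SCI-tableau with w⁺ : φ at its root, then φ is not SCI-satisfiable. -/

import Mathlib

/-- SCI-formulas: atoms, negation, implication, and the identity connective. -/
inductive SCIForm : Type
  | atom : ℕ → SCIForm
  | not : SCIForm → SCIForm
  | imp : SCIForm → SCIForm → SCIForm
  | idn : SCIForm → SCIForm → SCIForm
  deriving DecidableEq

/-- An SCI-structure over a carrier type `U`: a set of designated values and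
operations interpreting ¬, →, ≡. -/
structure SCIStruct (U : Type) where
  D : Set U
  neg : U → U
  imp : U → U → U
  idn : U → U → U

/-- `M` is an SCI-model: `U` is non-empty, `D` is a proper subset of `U`, and the
three semantic conditions hold. -/
def IsSCIModel {U : Type} (M : SCIStruct U) : Prop :=
  Nonempty U ∧ M.D ≠ Set.univ ∧
  (∀ a : U, M.neg a ∈ M.D ↔ a ∉ M.D) ∧
  (∀ a b : U, M.imp a b ∈ M.D ↔ (a ∉ M.D ∨ b ∈ M.D)) ∧
  (∀ a b : U, M.idn a b ∈ M.D ↔ a = b)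

/-- A valuation in an SCI-structure: a homomorphism from formulas to `U`. -/
def IsValuation {U : Type} (M : SCIStruct U) (V : SCIForm → U) : Prop :=
  (∀ φ, V (SCIForm.not φ) = M.neg (V φ)) ∧
  (∀ φ ψ, V (SCIForm.imp φ ψ) = M.imp (V φ) (V ψ)) ∧
  (∀ φ ψ, V (SCIForm.idn φ ψ) = M.idn (V φ) (V ψ))

/-- A formula is SCI-satisfiable if its denotation is designated in some
SCI-model under some valuation. -/
def SCISatisfiable (φ : SCIForm) : Prop :=
  ∃ (U : Type) (M : SCIStruct U) (V : SCIForm → U),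
    IsSCIModel M ∧ IsValuation M V ∧ V φ ∈ M.D

/-- A formula is SCI-valid if its denotation is designated in every SCI-model
under every valuation. -/
def SCIValid (φ : SCIForm) : Prop :=
  ∀ (U : Type) (M : SCIStruct U) (V : SCIForm → U),
    IsSCIModel M → IsValuation M V → V φ ∈ M.D

/-- Labels: a Boolean polarity (`true` = the set L⁺, `false` = the set L⁻)
together with a natural number index; L⁺ and L⁻ are disjoint and countably
infinite. -/
abbrev Label : Type := Bool × ℕ

/-- `w` belongs to L⁺. -/
def posL (w : Label) : Prop := w.1 = true

/-- `w` belongs to L⁻. -/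
def negL (w : Label) : Prop := w.1 = false

/-- Expressions occurring on tableau branches: labelled formulas `w : φ`,
equalities `w = v`, inequalities `w ≠ v`, and the closure symbol ⊥. -/
inductive Node : Type
  | lf : Label → SCIForm → Node
  | eq : Label → Label → Node
  | neq : Label → Label → Node
  | bot : Node
  deriving DecidableEq

/-- `|φ|`: the number of occurrences of subformulas of `φ`. -/
def SCIForm.size : SCIForm → ℕ
  | SCIForm.atom _ => 1
  | SCIForm.not φ => SCIForm.size φ + 1
  | SCIForm.imp φ ψ => SCIForm.size φ + SCIForm.size ψ + 1
  | SCIForm.idn φ ψ => SCIForm.size φ + SCIForm.size ψ + 1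

/-- A label is fresh on a branch: no labelled formula on the branch carries it. -/
def freshL (v : Label) (l : List Node) : Prop := ∀ φ, Node.lf v φ ∉ l

/-- One application of a TC_SCI rule extending a single branch.  A branch is a
list of nodes (in order of introduction, root first) together with the set `E`
of labelled formulas to which a decomposition rule has already been applied
(each decomposition rule may be applied only once to a given labelled formula,
each equality rule only if its conclusion is not yet on the branch, and no rule
is applied to a closed branch). -/
inductive Extend : List Node → Set (Label × SCIForm) → List Node → Set (Label × SCIForm) → Prop
  | negP (l : List Node) (E : Set (Label × SCIForm)) (w v : Label) (φ : SCIForm) :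
      Node.bot ∉ l → posL w → Node.lf w (SCIForm.not φ) ∈ l → (w, SCIForm.not φ) ∉ E →
      negL v → freshL v l →
      Extend l E (l ++ [Node.lf v φ]) (insert (w, SCIForm.not φ) E)
  | negN (l : List Node) (E : Set (Label × SCIForm)) (w v : Label) (φ : SCIForm) :
      Node.bot ∉ l → negL w → Node.lf w (SCIForm.not φ) ∈ l → (w, SCIForm.not φ) ∉ E →
      posL v → freshL v l →
      Extend l E (l ++ [Node.lf v φ]) (insert (w, SCIForm.not φ) E)
  | impP1 (l : List Node) (E : Set (Label × SCIForm)) (w v u : Label) (φ ψ : SCIForm) :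
      Node.bot ∉ l → posL w → Node.lf w (SCIForm.imp φ ψ) ∈ l → (w, SCIForm.imp φ ψ) ∉ E →
      negL v → negL u → v ≠ u → freshL v l → freshL u l →
      Extend l E (l ++ [Node.lf v φ, Node.lf u ψ]) (insert (w, SCIForm.imp φ ψ) E)
  | impP2 (l : List Node) (E : Set (Label × SCIForm)) (w v u : Label) (φ ψ : SCIForm) :
      Node.bot ∉ l → posL w → Node.lf w (SCIForm.imp φ ψ) ∈ l → (w, SCIForm.imp φ ψ) ∉ E →
      negL v → posL u → v ≠ u → freshL v l → freshL u l →
      Extend l E (l ++ [Node.lf v φ, Node.lf u ψ]) (insert (w, SCIForm.imp φ ψ) E)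
  | impP3 (l : List Node) (E : Set (Label × SCIForm)) (w v u : Label) (φ ψ : SCIForm) :
      Node.bot ∉ l → posL w → Node.lf w (SCIForm.imp φ ψ) ∈ l → (w, SCIForm.imp φ ψ) ∉ E →
      posL v → posL u → v ≠ u → freshL v l → freshL u l →
      Extend l E (l ++ [Node.lf v φ, Node.lf u ψ]) (insert (w, SCIForm.imp φ ψ) E)
  | impN (l : List Node) (E : Set (Label × SCIForm)) (w v u : Label) (φ ψ : SCIForm) :
      Node.bot ∉ l → negL w → Node.lf w (SCIForm.imp φ ψ) ∈ l → (w, SCIForm.imp φ ψ) ∉ E →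
      posL v → negL u → v ≠ u → freshL v l → freshL u l →
      Extend l E (l ++ [Node.lf v φ, Node.lf u ψ]) (insert (w, SCIForm.imp φ ψ) E)
  | idnP1 (l : List Node) (E : Set (Label × SCIForm)) (w v u : Label) (φ ψ : SCIForm) :
      Node.bot ∉ l → posL w → Node.lf w (SCIForm.idn φ ψ) ∈ l → (w, SCIForm.idn φ ψ) ∉ E →
      posL v → posL u → v ≠ u → freshL v l → freshL u l →
      Extend l E (l ++ [Node.lf v φ, Node.lf u ψ, Node.eq v u]) (insert (w, SCIForm.idn φ ψ) E)
  | idnP2 (l : List Node) (E : Set (Label × SCIForm)) (w v u : Label) (φ ψ : SCIForm) :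
      Node.bot ∉ l → posL w → Node.lf w (SCIForm.idn φ ψ) ∈ l → (w, SCIForm.idn φ ψ) ∉ E →
      negL v → negL u → v ≠ u → freshL v l → freshL u l →
      Extend l E (l ++ [Node.lf v φ, Node.lf u ψ, Node.eq v u]) (insert (w, SCIForm.idn φ ψ) E)
  | idnN1 (l : List Node) (E : Set (Label × SCIForm)) (w v u : Label) (φ ψ : SCIForm) :
      Node.bot ∉ l → negL w → Node.lf w (SCIForm.idn φ ψ) ∈ l → (w, SCIForm.idn φ ψ) ∉ E →
      posL v → posL u → v ≠ u → freshL v l → freshL u l →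
      Extend l E (l ++ [Node.lf v φ, Node.lf u ψ, Node.neq v u]) (insert (w, SCIForm.idn φ ψ) E)
  | idnN2 (l : List Node) (E : Set (Label × SCIForm)) (w v u : Label) (φ ψ : SCIForm) :
      Node.bot ∉ l → negL w → Node.lf w (SCIForm.idn φ ψ) ∈ l → (w, SCIForm.idn φ ψ) ∉ E →
      posL v → negL u → v ≠ u → freshL v l → freshL u l →
      Extend l E (l ++ [Node.lf v φ, Node.lf u ψ]) (insert (w, SCIForm.idn φ ψ) E)
  | idnN3 (l : List Node) (E : Set (Label × SCIForm)) (w v u : Label) (φ ψ : SCIForm) :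
      Node.bot ∉ l → negL w → Node.lf w (SCIForm.idn φ ψ) ∈ l → (w, SCIForm.idn φ ψ) ∉ E →
      negL v → posL u → v ≠ u → freshL v l → freshL u l →
      Extend l E (l ++ [Node.lf v φ, Node.lf u ψ]) (insert (w, SCIForm.idn φ ψ) E)
  | idnN4 (l : List Node) (E : Set (Label × SCIForm)) (w v u : Label) (φ ψ : SCIForm) :
      Node.bot ∉ l → negL w → Node.lf w (SCIForm.idn φ ψ) ∈ l → (w, SCIForm.idn φ ψ) ∉ E →
      negL v → negL u → v ≠ u → freshL v l → freshL u l →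
      Extend l E (l ++ [Node.lf v φ, Node.lf u ψ, Node.neq v u]) (insert (w, SCIForm.idn φ ψ) E)
  | eqNeg (l : List Node) (E : Set (Label × SCIForm)) (w v u y : Label) (φ ψ : SCIForm) :
      Node.bot ∉ l → Node.lf w φ ∈ l → Node.lf v ψ ∈ l → Node.eq w v ∈ l →
      Node.lf u (SCIForm.not φ) ∈ l → Node.lf y (SCIForm.not ψ) ∈ l →
      Node.eq u y ∉ l →
      Extend l E (l ++ [Node.eq u y]) E
  | eqImp (l : List Node) (E : Set (Label × SCIForm)) (w v w' v' x z : Label) (φ ψ χ θ : SCIForm) :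
      Node.bot ∉ l → Node.lf w φ ∈ l → Node.lf v ψ ∈ l → Node.eq w v ∈ l →
      Node.lf w' χ ∈ l → Node.lf v' θ ∈ l → Node.eq w' v' ∈ l →
      Node.lf x (SCIForm.imp φ χ) ∈ l → Node.lf z (SCIForm.imp ψ θ) ∈ l →
      Node.eq x z ∉ l →
      Extend l E (l ++ [Node.eq x z]) E
  | eqIdn (l : List Node) (E : Set (Label × SCIForm)) (w v w' v' x z : Label) (φ ψ χ θ : SCIForm) :
      Node.bot ∉ l → Node.lf w φ ∈ l → Node.lf v ψ ∈ l → Node.eq w v ∈ l →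
      Node.lf w' χ ∈ l → Node.lf v' θ ∈ l → Node.eq w' v' ∈ l →
      Node.lf x (SCIForm.idn φ χ) ∈ l → Node.lf z (SCIForm.idn ψ θ) ∈ l →
      Node.eq x z ∉ l →
      Extend l E (l ++ [Node.eq x z]) E
  | ruleF (l : List Node) (E : Set (Label × SCIForm)) (w v : Label) (φ : SCIForm) :
      Node.bot ∉ l → Node.lf w φ ∈ l → Node.lf v φ ∈ l → Node.eq w v ∉ l →
      Extend l E (l ++ [Node.eq w v]) E
  | ruleSym (l : List Node) (E : Set (Label × SCIForm)) (w v : Label) :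
      Node.bot ∉ l → Node.eq w v ∈ l → Node.eq v w ∉ l →
      Extend l E (l ++ [Node.eq v w]) E
  | ruleTran (l : List Node) (E : Set (Label × SCIForm)) (w v u : Label) :
      Node.bot ∉ l → Node.eq w v ∈ l → Node.eq v u ∈ l → Node.eq w u ∉ l →
      Extend l E (l ++ [Node.eq w u]) E
  | bot1 (l : List Node) (E : Set (Label × SCIForm)) (w v : Label) :
      Node.bot ∉ l → Node.eq w v ∈ l → Node.neq w v ∈ l →
      Extend l E (l ++ [Node.bot]) E
  | bot2 (l : List Node) (E : Set (Label × SCIForm)) (w v : Label) :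
      Node.bot ∉ l → posL w → negL v → Node.eq w v ∈ l →
      Extend l E (l ++ [Node.bot]) E

/-- `ClosedTab l E` holds iff there is a closed TC_SCI-tableau all of whose
branches extend the branch `l` (with `E` the set of labelled formulas already
decomposed on `l`): either a closure rule applies to `l`, or some rule of
TC_SCI can be applied so that all resulting branches carry closed tableaux. -/
inductive ClosedTab : List Node → Set (Label × SCIForm) → Prop
  | clos1 (l : List Node) (E : Set (Label × SCIForm)) (w v : Label) :
      Node.eq w v ∈ l → Node.neq w v ∈ l → ClosedTab l E
  | clos2 (l : List Node) (E : Set (Label × SCIForm)) (w v : Label) :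
      posL w → negL v → Node.eq w v ∈ l → ClosedTab l E
  | negP (l : List Node) (E : Set (Label × SCIForm)) (w v : Label) (φ : SCIForm) :
      posL w → Node.lf w (SCIForm.not φ) ∈ l → (w, SCIForm.not φ) ∉ E →
      negL v → freshL v l →
      ClosedTab (l ++ [Node.lf v φ]) (insert (w, SCIForm.not φ) E) →
      ClosedTab l E
  | negN (l : List Node) (E : Set (Label × SCIForm)) (w v : Label) (φ : SCIForm) :
      negL w → Node.lf w (SCIForm.not φ) ∈ l → (w, SCIForm.not φ) ∉ E →
      posL v → freshL v l →
      ClosedTab (l ++ [Node.lf v φ]) (insert (w, SCIForm.not φ) E) →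
      ClosedTab l E
  | impP (l : List Node) (E : Set (Label × SCIForm)) (w : Label) (φ ψ : SCIForm)
      (v1 u1 v2 u2 v3 u3 : Label) :
      posL w → Node.lf w (SCIForm.imp φ ψ) ∈ l → (w, SCIForm.imp φ ψ) ∉ E →
      negL v1 → negL u1 → v1 ≠ u1 → freshL v1 l → freshL u1 l →
      negL v2 → posL u2 → v2 ≠ u2 → freshL v2 l → freshL u2 l →
      posL v3 → posL u3 → v3 ≠ u3 → freshL v3 l → freshL u3 l →
      ClosedTab (l ++ [Node.lf v1 φ, Node.lf u1 ψ]) (insert (w, SCIForm.imp φ ψ) E) →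
      ClosedTab (l ++ [Node.lf v2 φ, Node.lf u2 ψ]) (insert (w, SCIForm.imp φ ψ) E) →
      ClosedTab (l ++ [Node.lf v3 φ, Node.lf u3 ψ]) (insert (w, SCIForm.imp φ ψ) E) →
      ClosedTab l E
  | impN (l : List Node) (E : Set (Label × SCIForm)) (w v u : Label) (φ ψ : SCIForm) :
      negL w → Node.lf w (SCIForm.imp φ ψ) ∈ l → (w, SCIForm.imp φ ψ) ∉ E →
      posL v → negL u → v ≠ u → freshL v l → freshL u l →
      ClosedTab (l ++ [Node.lf v φ, Node.lf u ψ]) (insert (w, SCIForm.imp φ ψ) E) →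
      ClosedTab l E
  | idnP (l : List Node) (E : Set (Label × SCIForm)) (w : Label) (φ ψ : SCIForm)
      (v1 u1 v2 u2 : Label) :
      posL w → Node.lf w (SCIForm.idn φ ψ) ∈ l → (w, SCIForm.idn φ ψ) ∉ E →
      posL v1 → posL u1 → v1 ≠ u1 → freshL v1 l → freshL u1 l →
      negL v2 → negL u2 → v2 ≠ u2 → freshL v2 l → freshL u2 l →
      ClosedTab (l ++ [Node.lf v1 φ, Node.lf u1 ψ, Node.eq v1 u1]) (insert (w, SCIForm.idn φ ψ) E) →
      ClosedTab (l ++ [Node.lf v2 φ, Node.lf u2 ψ, Node.eq v2 u2]) (insert (w, SCIForm.idn φ ψ) E) →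
      ClosedTab l E
  | idnN (l : List Node) (E : Set (Label × SCIForm)) (w : Label) (φ ψ : SCIForm)
      (v1 u1 v2 u2 v3 u3 v4 u4 : Label) :
      negL w → Node.lf w (SCIForm.idn φ ψ) ∈ l → (w, SCIForm.idn φ ψ) ∉ E →
      posL v1 → posL u1 → v1 ≠ u1 → freshL v1 l → freshL u1 l →
      posL v2 → negL u2 → v2 ≠ u2 → freshL v2 l → freshL u2 l →
      negL v3 → posL u3 → v3 ≠ u3 → freshL v3 l → freshL u3 l →
      negL v4 → negL u4 → v4 ≠ u4 → freshL v4 l → freshL u4 l →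
      ClosedTab (l ++ [Node.lf v1 φ, Node.lf u1 ψ, Node.neq v1 u1]) (insert (w, SCIForm.idn φ ψ) E) →
      ClosedTab (l ++ [Node.lf v2 φ, Node.lf u2 ψ]) (insert (w, SCIForm.idn φ ψ) E) →
      ClosedTab (l ++ [Node.lf v3 φ, Node.lf u3 ψ]) (insert (w, SCIForm.idn φ ψ) E) →
      ClosedTab (l ++ [Node.lf v4 φ, Node.lf u4 ψ, Node.neq v4 u4]) (insert (w, SCIForm.idn φ ψ) E) →
      ClosedTab l E
  | eqNeg (l : List Node) (E : Set (Label × SCIForm)) (w v u y : Label) (φ ψ : SCIForm) :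
      Node.lf w φ ∈ l → Node.lf v ψ ∈ l → Node.eq w v ∈ l →
      Node.lf u (SCIForm.not φ) ∈ l → Node.lf y (SCIForm.not ψ) ∈ l →
      Node.eq u y ∉ l →
      ClosedTab (l ++ [Node.eq u y]) E → ClosedTab l E
  | eqImp (l : List Node) (E : Set (Label × SCIForm)) (w v w' v' x z : Label) (φ ψ χ θ : SCIForm) :
      Node.lf w φ ∈ l → Node.lf v ψ ∈ l → Node.eq w v ∈ l →
      Node.lf w' χ ∈ l → Node.lf v' θ ∈ l → Node.eq w' v' ∈ l →
      Node.lf x (SCIForm.imp φ χ) ∈ l → Node.lf z (SCIForm.imp ψ θ) ∈ l →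
      Node.eq x z ∉ l →
      ClosedTab (l ++ [Node.eq x z]) E → ClosedTab l E
  | eqIdn (l : List Node) (E : Set (Label × SCIForm)) (w v w' v' x z : Label) (φ ψ χ θ : SCIForm) :
      Node.lf w φ ∈ l → Node.lf v ψ ∈ l → Node.eq w v ∈ l →
      Node.lf w' χ ∈ l → Node.lf v' θ ∈ l → Node.eq w' v' ∈ l →
      Node.lf x (SCIForm.idn φ χ) ∈ l → Node.lf z (SCIForm.idn ψ θ) ∈ l →
      Node.eq x z ∉ l →
      ClosedTab (l ++ [Node.eq x z]) E → ClosedTab l E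
  | ruleF (l : List Node) (E : Set (Label × SCIForm)) (w v : Label) (φ : SCIForm) :
      Node.lf w φ ∈ l → Node.lf v φ ∈ l → Node.eq w v ∉ l →
      ClosedTab (l ++ [Node.eq w v]) E → ClosedTab l E
  | ruleSym (l : List Node) (E : Set (Label × SCIForm)) (w v : Label) :
      Node.eq w v ∈ l → Node.eq v w ∉ l →
      ClosedTab (l ++ [Node.eq v w]) E → ClosedTab l E
  | ruleTran (l : List Node) (E : Set (Label × SCIForm)) (w v u : Label) :
      Node.eq w v ∈ l → Node.eq v u ∈ l → Node.eq w u ∉ l →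
      ClosedTab (l ++ [Node.eq w u]) E → ClosedTab l E

/-- φ is tableau-satisfiable with root label `w`: some branch obtained from the
root `w : φ` by finitely many TC_SCI rule applications is open (⊥ does not
occur on it) and fully expanded (no rule is applicable to it). -/
def TableauSatFrom (w : Label) (φ : SCIForm) : Prop :=
  ∃ (n : ℕ) (g : ℕ → List Node) (h : ℕ → Set (Label × SCIForm)),
    g 0 = [Node.lf w φ] ∧ h 0 = ∅ ∧
    (∀ i < n, Extend (g i) (h i) (g (i + 1)) (h (i + 1))) ∧
    Node.bot ∉ g n ∧ (∀ l' E', ¬ Extend (g n) (h n) l' E')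

/-- The branch `l` is realised in `M` under `V`, the label `w` denoting `f w`. -/
structure Realizes {U : Type} (M : SCIStruct U) (V : SCIForm → U) (l : List Node)
    (f : Label → U) : Prop where
  bot : Node.bot ∉ l
  lf : ∀ w φ, Node.lf w φ ∈ l → f w = V φ
  polarity : ∀ w φ, Node.lf w φ ∈ l → (w.1 = true ↔ V φ ∈ M.D)
  eq : ∀ w v, Node.eq w v ∈ l → ¬ freshL w l ∧ ¬ freshL v l ∧ f w = f v
  neq : ∀ w v, Node.neq w v ∈ l → ¬ freshL w l ∧ ¬ freshL v l ∧ f w ≠ f v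

theorem not_freshL_of_mem {w : Label} {φ : SCIForm} {l : List Node} (h : Node.lf w φ ∈ l) :
    ¬ freshL w l := fun hw => hw φ h

theorem not_freshL_append {w : Label} {l : List Node} (l' : List Node) (h : ¬ freshL w l) :
    ¬ freshL w (l ++ l') :=
  fun hw => h fun φ hφ => hw φ (List.mem_append_left _ hφ)

namespace Realizes

variable {U : Type} {M : SCIStruct U} {V : SCIForm → U} {l : List Node} {f : Label → U}

theorem append_lf (h : Realizes M V l f) {v : Label} {φ : SCIForm} (hv : freshL v l)
    (hp : v.1 = true ↔ V φ ∈ M.D) :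
    Realizes M V (l ++ [Node.lf v φ]) (Function.update f v (V φ)) := by
  have ne_of : ∀ w, ¬ freshL w l → w ≠ v := fun w hw e => hw (e ▸ hv)
  constructor
  · simpa using h.bot
  · intro w ψ hw
    simp only [List.mem_append, List.mem_singleton, Node.lf.injEq] at hw
    rcases hw with hw | ⟨rfl, rfl⟩
    · rw [Function.update_of_ne (ne_of w (not_freshL_of_mem hw)), h.lf w ψ hw]
    · simp
  · intro w ψ hw
    simp only [List.mem_append, List.mem_singleton, Node.lf.injEq] at hw
    rcases hw with hw | ⟨rfl, rfl⟩
    · exact h.polarity w ψ hw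
    · exact hp
  · intro w u hw
    obtain ⟨h1, h2, h3⟩ := h.eq w u (by simpa using hw)
    exact ⟨not_freshL_append _ h1, not_freshL_append _ h2, by
      rwa [Function.update_of_ne (ne_of w h1), Function.update_of_ne (ne_of u h2)]⟩
  · intro w u hw
    obtain ⟨h1, h2, h3⟩ := h.neq w u (by simpa using hw)
    exact ⟨not_freshL_append _ h1, not_freshL_append _ h2, by
      rwa [Function.update_of_ne (ne_of w h1), Function.update_of_ne (ne_of u h2)]⟩

theorem append_eq (h : Realizes M V l f) {w v : Label} (hw : ¬ freshL w l) (hv : ¬ freshL v l)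
    (he : f w = f v) : Realizes M V (l ++ [Node.eq w v]) f := by
  constructor
  · simpa using h.bot
  · intro a ψ ha
    exact h.lf a ψ (by simpa using ha)
  · intro a ψ ha
    exact h.polarity a ψ (by simpa using ha)
  · intro a b hab
    simp only [List.mem_append, List.mem_singleton, Node.eq.injEq] at hab
    rcases hab with hab | ⟨rfl, rfl⟩
    · obtain ⟨h1, h2, h3⟩ := h.eq a b hab
      exact ⟨not_freshL_append _ h1, not_freshL_append _ h2, h3⟩
    · exact ⟨not_freshL_append _ hw, not_freshL_append _ hv, he⟩
  · intro a b hab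
    obtain ⟨h1, h2, h3⟩ := h.neq a b (by simpa using hab)
    exact ⟨not_freshL_append _ h1, not_freshL_append _ h2, h3⟩

theorem append_neq (h : Realizes M V l f) {w v : Label} (hw : ¬ freshL w l) (hv : ¬ freshL v l)
    (he : f w ≠ f v) : Realizes M V (l ++ [Node.neq w v]) f := by
  constructor
  · simpa using h.bot
  · intro a ψ ha
    exact h.lf a ψ (by simpa using ha)
  · intro a ψ ha
    exact h.polarity a ψ (by simpa using ha)
  · intro a b hab
    obtain ⟨h1, h2, h3⟩ := h.eq a b (by simpa using hab)
    exact ⟨not_freshL_append _ h1, not_freshL_append _ h2, h3⟩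
  · intro a b hab
    simp only [List.mem_append, List.mem_singleton, Node.neq.injEq] at hab
    rcases hab with hab | ⟨rfl, rfl⟩
    · obtain ⟨h1, h2, h3⟩ := h.neq a b hab
      exact ⟨not_freshL_append _ h1, not_freshL_append _ h2, h3⟩
    · exact ⟨not_freshL_append _ hw, not_freshL_append _ hv, he⟩

theorem append_lf_lf (h : Realizes M V l f) {v u : Label} {φ ψ : SCIForm} (hvu : v ≠ u)
    (hv : freshL v l) (hu : freshL u l) (hpv : v.1 = true ↔ V φ ∈ M.D)
    (hpu : u.1 = true ↔ V ψ ∈ M.D) :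
    ∃ f', Realizes M V (l ++ [Node.lf v φ, Node.lf u ψ]) f' := by
  have hu' : freshL u (l ++ [Node.lf v φ]) := by
    intro χ hχ
    simp only [List.mem_append, List.mem_singleton, Node.lf.injEq] at hχ
    rcases hχ with hχ | ⟨rfl, -⟩
    · exact hu χ hχ
    · exact hvu rfl
  have key := (h.append_lf hv hpv).append_lf hu' hpu
  rw [List.append_assoc] at key
  exact ⟨_, key⟩

theorem append_lf_lf_eq (h : Realizes M V l f) {v u : Label} {φ ψ : SCIForm} (hvu : v ≠ u)
    (hv : freshL v l) (hu : freshL u l) (hpv : v.1 = true ↔ V φ ∈ M.D)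
    (hpu : u.1 = true ↔ V ψ ∈ M.D) (he : V φ = V ψ) :
    ∃ f', Realizes M V (l ++ [Node.lf v φ, Node.lf u ψ, Node.eq v u]) f' := by
  obtain ⟨f', h'⟩ := h.append_lf_lf hvu hv hu hpv hpu
  have mv : Node.lf v φ ∈ l ++ [Node.lf v φ, Node.lf u ψ] := by simp
  have mu : Node.lf u ψ ∈ l ++ [Node.lf v φ, Node.lf u ψ] := by simp
  have key := h'.append_eq (not_freshL_of_mem mv) (not_freshL_of_mem mu)
    (by rw [h'.lf _ _ mv, h'.lf _ _ mu, he])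
  rw [List.append_assoc] at key
  exact ⟨_, key⟩

theorem append_lf_lf_neq (h : Realizes M V l f) {v u : Label} {φ ψ : SCIForm} (hvu : v ≠ u)
    (hv : freshL v l) (hu : freshL u l) (hpv : v.1 = true ↔ V φ ∈ M.D)
    (hpu : u.1 = true ↔ V ψ ∈ M.D) (he : V φ ≠ V ψ) :
    ∃ f', Realizes M V (l ++ [Node.lf v φ, Node.lf u ψ, Node.neq v u]) f' := by
  obtain ⟨f', h'⟩ := h.append_lf_lf hvu hv hu hpv hpu
  have mv : Node.lf v φ ∈ l ++ [Node.lf v φ, Node.lf u ψ] := by simp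
  have mu : Node.lf u ψ ∈ l ++ [Node.lf v φ, Node.lf u ψ] := by simp
  have key := h'.append_neq (not_freshL_of_mem mv) (not_freshL_of_mem mu)
    (by rwa [h'.lf _ _ mv, h'.lf _ _ mu])
  rw [List.append_assoc] at key
  exact ⟨_, key⟩

theorem not_mem_neq (h : Realizes M V l f) {w v : Label} (he : Node.eq w v ∈ l) :
    Node.neq w v ∉ l :=
  fun hn => (h.neq w v hn).2.2 (h.eq w v he).2.2

theorem polarity_eq (h : Realizes M V l f) {w v : Label} (he : Node.eq w v ∈ l) :
    w.1 = true ↔ v.1 = true := by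
  obtain ⟨hw, hv, hwv⟩ := h.eq w v he
  simp only [freshL, not_forall, not_not] at hw hv
  obtain ⟨φ, hφ⟩ := hw
  obtain ⟨ψ, hψ⟩ := hv
  rw [h.polarity _ _ hφ, h.polarity _ _ hψ, ← h.lf _ _ hφ, ← h.lf _ _ hψ, hwv]

theorem value_eq (h : Realizes M V l f) {w v : Label} {φ ψ : SCIForm} (hw : Node.lf w φ ∈ l)
    (hv : Node.lf v ψ ∈ l) (he : Node.eq w v ∈ l) : V φ = V ψ := by
  rw [← h.lf _ _ hw, ← h.lf _ _ hv, (h.eq _ _ he).2.2]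

theorem append_eq_of_value_eq (h : Realizes M V l f) {w v : Label} {φ ψ : SCIForm}
    (hw : Node.lf w φ ∈ l) (hv : Node.lf v ψ ∈ l) (he : V φ = V ψ) :
    Realizes M V (l ++ [Node.eq w v]) f :=
  h.append_eq (not_freshL_of_mem hw) (not_freshL_of_mem hv)
    (by rw [h.lf _ _ hw, h.lf _ _ hv, he])

theorem singleton {w : Label} {φ : SCIForm} (hw : posL w) (hφ : V φ ∈ M.D) :
    Realizes M V [Node.lf w φ] (fun _ => V φ) := by
  simp only [posL] at hw
  constructor <;> simp +contextual [hw, hφ]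

end Realizes

/-- A branch carrying a closed tableau is not realised in any model. -/
theorem ClosedTab.not_realizes {U : Type} {M : SCIStruct U} {V : SCIForm → U}
    (hM : IsSCIModel M) (hV : IsValuation M V) {l : List Node} {E : Set (Label × SCIForm)}
    (hc : ClosedTab l E) : ∀ f, ¬ Realizes M V l f := by
  obtain ⟨-, -, hneg, himp, hidn⟩ := hM
  obtain ⟨vneg, vimp, vidn⟩ := hV
  induction hc with
  | clos1 l E w v he hn => exact fun f h => h.not_mem_neq he hn
  | clos2 l E w v hw hv he =>
    intro f h
    have := h.polarity_eq he
    simp_all [posL, negL]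
  | negP l E w v φ hw hm _ hv hf _ ih =>
    intro f h
    have := h.polarity _ _ hm
    exact ih _ (h.append_lf hf (by simp_all [posL, negL]))
  | negN l E w v φ hw hm _ hv hf _ ih =>
    intro f h
    have := h.polarity _ _ hm
    exact ih _ (h.append_lf hf (by simp_all [posL, negL]))
  | impP l E w φ ψ v1 u1 v2 u2 v3 u3 hw hm _ pv1 pu1 n1 fv1 fu1 pv2 pu2 n2 fv2 fu2
      pv3 pu3 n3 fv3 fu3 _ _ _ ih1 ih2 ih3 =>
    intro f h
    have hp := h.polarity _ _ hm
    simp only [posL, negL] at *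
    rw [vimp, himp, hw] at hp
    by_cases hφ : V φ ∈ M.D <;> by_cases hψ : V ψ ∈ M.D
    · obtain ⟨f', h'⟩ := h.append_lf_lf n3 fv3 fu3 (φ := φ) (ψ := ψ) (by simp [*]) (by simp [*])
      exact ih3 _ h'
    · simp_all
    · obtain ⟨f', h'⟩ := h.append_lf_lf n2 fv2 fu2 (φ := φ) (ψ := ψ) (by simp [*]) (by simp [*])
      exact ih2 _ h'
    · obtain ⟨f', h'⟩ := h.append_lf_lf n1 fv1 fu1 (φ := φ) (ψ := ψ) (by simp [*]) (by simp [*])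
      exact ih1 _ h'
  | impN l E w v u φ ψ hw hm _ pv pu n fv fu _ ih =>
    intro f h
    have hp := h.polarity _ _ hm
    simp only [posL, negL] at *
    rw [vimp, himp, hw] at hp
    simp only [Bool.false_eq_true, false_iff, not_or, not_not] at hp
    obtain ⟨f', h'⟩ := h.append_lf_lf n fv fu (φ := φ) (ψ := ψ) (by simp [*]) (by simp [*])
    exact ih _ h'
  | idnP l E w φ ψ v1 u1 v2 u2 hw hm _ pv1 pu1 n1 fv1 fu1 pv2 pu2 n2 fv2 fu2 _ _ ih1 ih2 =>
    intro f h
    have hp := h.polarity _ _ hm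
    simp only [posL, negL] at *
    rw [vidn, hidn, hw] at hp
    have he : V φ = V ψ := hp.1 rfl
    by_cases hψ : V ψ ∈ M.D
    · obtain ⟨f', h'⟩ := h.append_lf_lf_eq n1 fv1 fu1 (φ := φ) (ψ := ψ)
        (by simp [*]) (by simp [*]) he
      exact ih1 _ h'
    · obtain ⟨f', h'⟩ := h.append_lf_lf_eq n2 fv2 fu2 (φ := φ) (ψ := ψ)
        (by simp [*]) (by simp [*]) he
      exact ih2 _ h'
  | idnN l E w φ ψ v1 u1 v2 u2 v3 u3 v4 u4 hw hm _ pv1 pu1 n1 fv1 fu1 pv2 pu2 n2 fv2 fu2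
      pv3 pu3 n3 fv3 fu3 pv4 pu4 n4 fv4 fu4 _ _ _ _ ih1 ih2 ih3 ih4 =>
    intro f h
    have hp := h.polarity _ _ hm
    simp only [posL, negL] at *
    rw [vidn, hidn, hw] at hp
    have he : V φ ≠ V ψ := fun e => absurd (hp.2 e) (by simp)
    by_cases hφ : V φ ∈ M.D <;> by_cases hψ : V ψ ∈ M.D
    · obtain ⟨f', h'⟩ := h.append_lf_lf_neq n1 fv1 fu1 (φ := φ) (ψ := ψ)
        (by simp [*]) (by simp [*]) he
      exact ih1 _ h'
    · obtain ⟨f', h'⟩ := h.append_lf_lf n2 fv2 fu2 (φ := φ) (ψ := ψ) (by simp [*]) (by simp [*])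
      exact ih2 _ h'
    · obtain ⟨f', h'⟩ := h.append_lf_lf n3 fv3 fu3 (φ := φ) (ψ := ψ) (by simp [*]) (by simp [*])
      exact ih3 _ h'
    · obtain ⟨f', h'⟩ := h.append_lf_lf_neq n4 fv4 fu4 (φ := φ) (ψ := ψ)
        (by simp [*]) (by simp [*]) he
      exact ih4 _ h'
  | eqNeg l E w v u y φ ψ hw hv he hu hy _ _ ih =>
    exact fun f h => ih f (h.append_eq_of_value_eq hu hy
      (by rw [vneg, vneg, h.value_eq hw hv he]))
  | eqImp l E w v w' v' x z φ ψ χ θ hw hv he hw' hv' he' hx hz _ _ ih =>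
    exact fun f h => ih f (h.append_eq_of_value_eq hx hz
      (by rw [vimp, vimp, h.value_eq hw hv he, h.value_eq hw' hv' he']))
  | eqIdn l E w v w' v' x z φ ψ χ θ hw hv he hw' hv' he' hx hz _ _ ih =>
    exact fun f h => ih f (h.append_eq_of_value_eq hx hz
      (by rw [vidn, vidn, h.value_eq hw hv he, h.value_eq hw' hv' he']))
  | ruleF l E w v φ hw hv _ _ ih =>
    exact fun f h => ih f (h.append_eq_of_value_eq hw hv rfl)
  | ruleSym l E w v he _ _ ih =>
    intro f h
    obtain ⟨h1, h2, h3⟩ := h.eq _ _ he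
    exact ih f (h.append_eq h2 h1 h3.symm)
  | ruleTran l E w v u he he' _ _ ih =>
    intro f h
    obtain ⟨h1, _, h3⟩ := h.eq _ _ he
    obtain ⟨_, h2, h4⟩ := h.eq _ _ he'
    exact ih f (h.append_eq h1 h2 (h3.trans h4))

theorem exists_forall_freshL (l : List Node) : ∃ n : ℕ, ∀ m, n ≤ m → ∀ b, freshL (b, m) l := by
  induction l with
  | nil => exact ⟨0, fun m _ b φ h => by simp at h⟩
  | cons a l ih =>
    obtain ⟨n, hn⟩ := ih
    cases a with
    | lf w ψ =>
      refine ⟨max n (w.2 + 1), fun m hm b φ h => ?_⟩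
      simp only [List.mem_cons, Node.lf.injEq] at h
      rcases h with ⟨rfl, -⟩ | h
      · simp at hm
      · exact hn m (le_trans (le_max_left _ _) hm) b φ h
    | _ => exact ⟨n, fun m hm b φ h => hn m hm b φ (by simpa using h)⟩

theorem exists_freshL_pair (l : List Node) (b c : Bool) :
    ∃ v u : Label, v.1 = b ∧ u.1 = c ∧ v ≠ u ∧ freshL v l ∧ freshL u l := by
  obtain ⟨n, hn⟩ := exists_forall_freshL l
  exact ⟨(b, n), (c, n + 1), rfl, rfl, by simp, hn n le_rfl b, hn (n + 1) (by omega) c⟩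

open Classical in
/-- The contribution of a node to `pendingSize`. -/
noncomputable def pendingWeight (E : Set (Label × SCIForm)) : Node → ℕ
  | Node.lf w φ => if (w, φ) ∈ E then 0 else φ.size
  | _ => 0

/-- The total size of the labelled formulas on the branch that are not yet decomposed. -/
noncomputable def pendingSize (l : List Node) (E : Set (Label × SCIForm)) : ℕ :=
  (l.map (pendingWeight E)).sum

/-- The labels carried by the labelled formulas of the branch. -/
def branchLabels (l : List Node) : Finset Label :=
  (l.filterMap fun | Node.lf w _ => some w | _ => none).toFinset

/-- The number of pairs of labels of the branch whose equality is not on the branch. -/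
def missingEqs (l : List Node) : ℕ :=
  ((branchLabels l ×ˢ branchLabels l).filter fun p => Node.eq p.1 p.2 ∉ l).card

theorem mem_branchLabels {l : List Node} {w : Label} : w ∈ branchLabels l ↔ ¬ freshL w l := by
  simp only [branchLabels, List.mem_toFinset, List.mem_filterMap, freshL, not_forall, not_not]
  constructor
  · rintro ⟨a, ha, h⟩
    cases a <;> simp_all
    exact ⟨_, ha⟩
  · rintro ⟨φ, h⟩
    exact ⟨_, h, rfl⟩

theorem missingEqs_append_eq_lt {l : List Node} {w v : Label} (hw : ¬ freshL w l)
    (hv : ¬ freshL v l) (hn : Node.eq w v ∉ l) :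
    missingEqs (l ++ [Node.eq w v]) < missingEqs l := by
  have hl : branchLabels (l ++ [Node.eq w v]) = branchLabels l := by simp [branchLabels]
  rw [missingEqs, missingEqs, hl]
  apply Finset.card_lt_card
  refine Finset.ssubset_iff_of_subset ?_ |>.2 ⟨(w, v), ?_, ?_⟩
  · intro p hp
    simp only [Finset.mem_filter, List.mem_append, not_or] at hp ⊢
    exact ⟨hp.1, hp.2.1⟩
  · simp [mem_branchLabels, hw, hv, hn]
  · simp

theorem pendingSize_append_eq (l : List Node) (E : Set (Label × SCIForm)) (w v : Label) :
    pendingSize (l ++ [Node.eq w v]) E = pendingSize l E := by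
  simp [pendingSize, pendingWeight]

theorem pendingWeight_insert_le (E : Set (Label × SCIForm)) (p : Label × SCIForm) (a : Node) :
    pendingWeight (insert p E) a ≤ pendingWeight E a := by
  cases a <;> simp only [pendingWeight, le_refl]
  split_ifs <;> simp_all

theorem pendingWeight_lf_le (E : Set (Label × SCIForm)) (w : Label) (φ : SCIForm) :
    pendingWeight E (Node.lf w φ) ≤ φ.size := by
  simp only [pendingWeight]
  split_ifs <;> simp

theorem pendingSize_insert_add_le {l : List Node} {E : Set (Label × SCIForm)} {w : Label}
    {φ : SCIForm} (hm : Node.lf w φ ∈ l) (hE : (w, φ) ∉ E) :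
    pendingSize l (insert (w, φ) E) + φ.size ≤ pendingSize l E := by
  obtain ⟨s, t, rfl⟩ := List.append_of_mem hm
  have mono : ∀ k : List Node, (k.map (pendingWeight (insert (w, φ) E))).sum ≤
      (k.map (pendingWeight E)).sum :=
    fun k => List.sum_le_sum fun a _ => pendingWeight_insert_le E _ a
  have h0 : pendingWeight (insert (w, φ) E) (Node.lf w φ) = 0 := by simp [pendingWeight]
  have h1 : pendingWeight E (Node.lf w φ) = φ.size := by simp [pendingWeight, hE]
  have := mono s
  have := mono t
  simp only [pendingSize, List.map_append, List.map_cons, List.sum_append, List.sum_cons, h0, h1]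
  omega

theorem pendingSize_append_lt {l k : List Node} {E : Set (Label × SCIForm)} {w : Label}
    {φ : SCIForm} (hm : Node.lf w φ ∈ l) (hE : (w, φ) ∉ E)
    (hk : pendingSize k (insert (w, φ) E) < φ.size) :
    pendingSize (l ++ k) (insert (w, φ) E) < pendingSize l E := by
  have h := pendingSize_insert_add_le hm hE
  simp only [pendingSize, List.map_append, List.sum_append] at *
  omega

/-- One rule application yields a realised branch of smaller measure. -/
def Progress {U : Type} (M : SCIStruct U) (V : SCIForm → U) (l : List Node)
    (E : Set (Label × SCIForm)) : Prop :=
  ∃ l' E' f', Extend l E l' E' ∧ Realizes M V l' f' ∧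
    Prod.Lex (· < ·) (· < ·) (pendingSize l' E', missingEqs l') (pendingSize l E, missingEqs l)

section Progress

variable {U : Type} {M : SCIStruct U} {V : SCIForm → U} {l : List Node} {f : Label → U}
  {E : Set (Label × SCIForm)} {w : Label} {φ ψ : SCIForm}

theorem Realizes.progress_append_eq {v : Label}
    (h' : Realizes M V (l ++ [Node.eq w v]) f) (hx : Extend l E (l ++ [Node.eq w v]) E)
    (hn : Node.eq w v ∉ l) : Progress M V l E := by
  obtain ⟨hw, hv, -⟩ := h'.eq w v (by simp)
  refine ⟨_, _, f, hx, h', ?_⟩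
  rw [pendingSize_append_eq]
  refine Prod.Lex.right _ (missingEqs_append_eq_lt ?_ ?_ hn)
  · exact fun hf => hw fun φ hφ => hf φ (by simpa using hφ)
  · exact fun hf => hv fun φ hφ => hf φ (by simpa using hφ)

theorem progress_of_pendingSize_lt {k : List Node} (hm : Node.lf w φ ∈ l) (hE : (w, φ) ∉ E)
    (hx : Extend l E (l ++ k) (insert (w, φ) E)) (h' : ∃ f', Realizes M V (l ++ k) f')
    (hk : pendingSize k (insert (w, φ) E) < φ.size) : Progress M V l E := by
  obtain ⟨f', h'⟩ := h'
  exact ⟨_, _, f', hx, h', Prod.Lex.left _ _ (pendingSize_append_lt hm hE hk)⟩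

theorem Realizes.progress_not (hM : IsSCIModel M) (hV : IsValuation M V) (h : Realizes M V l f)
    (hm : Node.lf w (SCIForm.not φ) ∈ l) (hE : (w, SCIForm.not φ) ∉ E) : Progress M V l E := by
  have hp := h.polarity _ _ hm
  rw [hV.1, hM.2.2.1] at hp
  have hk : ∀ v, pendingSize [Node.lf v φ] (insert (w, SCIForm.not φ) E) <
      (SCIForm.not φ).size := by
    intro v
    have := pendingWeight_lf_le (insert (w, SCIForm.not φ) E) v φ
    simp only [pendingSize, List.map_cons, List.map_nil, List.sum_cons, List.sum_nil,
      SCIForm.size]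
    omega
  obtain ⟨v, -, hv, -, -, fv, -⟩ := exists_freshL_pair l (!w.1) true
  cases hw : w.1 <;> rw [hw] at hp hv
  · exact progress_of_pendingSize_lt hm hE (.negN l E w v φ h.bot hw hm hE hv fv)
      ⟨_, h.append_lf fv (by simp_all)⟩ (hk v)
  · exact progress_of_pendingSize_lt hm hE (.negP l E w v φ h.bot hw hm hE hv fv)
      ⟨_, h.append_lf fv (by simp_all)⟩ (hk v)

theorem pendingSize_pair_le (E : Set (Label × SCIForm)) (v u : Label) (φ ψ : SCIForm) :
    pendingSize [Node.lf v φ, Node.lf u ψ] E ≤ φ.size + ψ.size := by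
  have := pendingWeight_lf_le E v φ
  have := pendingWeight_lf_le E u ψ
  simp only [pendingSize, List.map_cons, List.map_nil, List.sum_cons, List.sum_nil]
  omega

theorem Realizes.progress_imp (hM : IsSCIModel M) (hV : IsValuation M V) (h : Realizes M V l f)
    (hm : Node.lf w (SCIForm.imp φ ψ) ∈ l) (hE : (w, SCIForm.imp φ ψ) ∉ E) :
    Progress M V l E := by
  classical
  have hp := h.polarity _ _ hm
  rw [hV.2.1, hM.2.2.2.1] at hp
  obtain ⟨v, u, hv, hu, n, fv, fu⟩ :=
    exists_freshL_pair l (decide (V φ ∈ M.D)) (decide (V ψ ∈ M.D))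
  have hr := h.append_lf_lf n fv fu (φ := φ) (ψ := ψ) (by simp [hv]) (by simp [hu])
  have hk := Nat.lt_succ_of_le
    (pendingSize_pair_le (insert (w, SCIForm.imp φ ψ) E) v u φ ψ)
  refine progress_of_pendingSize_lt hm hE ?_ hr hk
  cases hw : w.1 <;> rw [hw] at hp <;> by_cases hφ : V φ ∈ M.D <;> by_cases hψ : V ψ ∈ M.D <;>
    simp only [hφ, hψ, decide_true, decide_false] at hv hu <;> simp [hφ, hψ] at hp
  · exact .impN l E w v u φ ψ h.bot hw hm hE hv hu n fv fu
  · exact .impP3 l E w v u φ ψ h.bot hw hm hE hv hu n fv fu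
  · exact .impP2 l E w v u φ ψ h.bot hw hm hE hv hu n fv fu
  · exact .impP1 l E w v u φ ψ h.bot hw hm hE hv hu n fv fu

theorem Realizes.progress_idn (hM : IsSCIModel M) (hV : IsValuation M V) (h : Realizes M V l f)
    (hm : Node.lf w (SCIForm.idn φ ψ) ∈ l) (hE : (w, SCIForm.idn φ ψ) ∉ E) :
    Progress M V l E := by
  classical
  have hp := h.polarity _ _ hm
  rw [hV.2.2, hM.2.2.2.2] at hp
  obtain ⟨v, u, hv, hu, n, fv, fu⟩ :=
    exists_freshL_pair l (decide (V φ ∈ M.D)) (decide (V ψ ∈ M.D))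
  have hpv : v.1 = true ↔ V φ ∈ M.D := by simp [hv]
  have hpu : u.1 = true ↔ V ψ ∈ M.D := by simp [hu]
  have hk := Nat.lt_succ_of_le
    (pendingSize_pair_le (insert (w, SCIForm.idn φ ψ) E) v u φ ψ)
  have hkEq : pendingSize [Node.lf v φ, Node.lf u ψ, Node.eq v u]
      (insert (w, SCIForm.idn φ ψ) E) < (SCIForm.idn φ ψ).size := by
    simpa [pendingSize, pendingWeight, SCIForm.size] using hk
  have hkNeq : pendingSize [Node.lf v φ, Node.lf u ψ, Node.neq v u]
      (insert (w, SCIForm.idn φ ψ) E) < (SCIForm.idn φ ψ).size := by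
    simpa [pendingSize, pendingWeight, SCIForm.size] using hk
  cases hw : w.1 <;> rw [hw] at hp
  · have he : V φ ≠ V ψ := fun e => absurd (hp.2 e) (by simp)
    by_cases hφ : V φ ∈ M.D <;> by_cases hψ : V ψ ∈ M.D <;>
      simp only [hφ, hψ, decide_true, decide_false] at hv hu
    · exact progress_of_pendingSize_lt hm hE
        (.idnN1 l E w v u φ ψ h.bot hw hm hE hv hu n fv fu)
        (h.append_lf_lf_neq n fv fu hpv hpu he) hkNeq
    · exact progress_of_pendingSize_lt hm hE
        (.idnN2 l E w v u φ ψ h.bot hw hm hE hv hu n fv fu)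
        (h.append_lf_lf n fv fu hpv hpu) hk
    · exact progress_of_pendingSize_lt hm hE
        (.idnN3 l E w v u φ ψ h.bot hw hm hE hv hu n fv fu)
        (h.append_lf_lf n fv fu hpv hpu) hk
    · exact progress_of_pendingSize_lt hm hE
        (.idnN4 l E w v u φ ψ h.bot hw hm hE hv hu n fv fu)
        (h.append_lf_lf_neq n fv fu hpv hpu he) hkNeq
  · have he : V φ = V ψ := hp.1 rfl
    refine progress_of_pendingSize_lt hm hE ?_ (h.append_lf_lf_eq n fv fu hpv hpu he) hkEq
    rw [he] at hv
    by_cases hψ : V ψ ∈ M.D <;> simp only [hψ, decide_true, decide_false] at hv hu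
    · exact .idnP1 l E w v u φ ψ h.bot hw hm hE hv hu n fv fu
    · exact .idnP2 l E w v u φ ψ h.bot hw hm hE hv hu n fv fu

/-- A realised branch that is not fully expanded makes progress. -/
theorem Realizes.progress (hM : IsSCIModel M) (hV : IsValuation M V) (h : Realizes M V l f)
    {l' : List Node} {E' : Set (Label × SCIForm)} (hx : Extend l E l' E') :
    Progress M V l E := by
  have hx' := hx
  cases hx with
  | negP w v φ _ _ hm hE => exact h.progress_not hM hV hm hE
  | negN w v φ _ _ hm hE => exact h.progress_not hM hV hm hE
  | impP1 w v u φ ψ _ _ hm hE => exact h.progress_imp hM hV hm hE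
  | impP2 w v u φ ψ _ _ hm hE => exact h.progress_imp hM hV hm hE
  | impP3 w v u φ ψ _ _ hm hE => exact h.progress_imp hM hV hm hE
  | impN w v u φ ψ _ _ hm hE => exact h.progress_imp hM hV hm hE
  | idnP1 w v u φ ψ _ _ hm hE => exact h.progress_idn hM hV hm hE
  | idnP2 w v u φ ψ _ _ hm hE => exact h.progress_idn hM hV hm hE
  | idnN1 w v u φ ψ _ _ hm hE => exact h.progress_idn hM hV hm hE
  | idnN2 w v u φ ψ _ _ hm hE => exact h.progress_idn hM hV hm hE
  | idnN3 w v u φ ψ _ _ hm hE => exact h.progress_idn hM hV hm hE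
  | idnN4 w v u φ ψ _ _ hm hE => exact h.progress_idn hM hV hm hE
  | eqNeg w v u y φ ψ _ hw hv he hu hy hn =>
    exact (h.append_eq_of_value_eq hu hy
      (by rw [hV.1, hV.1, h.value_eq hw hv he])).progress_append_eq hx' hn
  | eqImp w v w' v' x z φ ψ χ θ _ hw hv he hw' hv' he' hx hz hn =>
    exact (h.append_eq_of_value_eq hx hz
      (by rw [hV.2.1, hV.2.1, h.value_eq hw hv he, h.value_eq hw' hv' he'])).progress_append_eq hx' hn
  | eqIdn w v w' v' x z φ ψ χ θ _ hw hv he hw' hv' he' hx hz hn =>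
    exact (h.append_eq_of_value_eq hx hz
      (by rw [hV.2.2, hV.2.2, h.value_eq hw hv he, h.value_eq hw' hv' he'])).progress_append_eq hx' hn
  | ruleF w v φ _ hw hv hn =>
    exact (h.append_eq_of_value_eq hw hv rfl).progress_append_eq hx' hn
  | ruleSym w v _ he hn =>
    obtain ⟨h1, h2, h3⟩ := h.eq _ _ he
    exact (h.append_eq h2 h1 h3.symm).progress_append_eq hx' hn
  | ruleTran w v u _ he he' hn =>
    obtain ⟨h1, _, h3⟩ := h.eq _ _ he
    obtain ⟨_, h2, h4⟩ := h.eq _ _ he'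
    exact (h.append_eq h1 h2 (h3.trans h4)).progress_append_eq hx' hn
  | bot1 w v _ he hn => exact absurd hn (h.not_mem_neq he)
  | bot2 w v _ hw hv he =>
    have := h.polarity_eq he
    simp_all [posL, negL]

end Progress

/-- Every realised branch extends to an open, fully expanded branch. -/
theorem Realizes.exists_fullyExpanded {U : Type} {M : SCIStruct U} {V : SCIForm → U}
    (hM : IsSCIModel M) (hV : IsValuation M V) {l : List Node} {f : Label → U}
    (E : Set (Label × SCIForm)) (h : Realizes M V l f) :
    ∃ (n : ℕ) (g : ℕ → List Node) (k : ℕ → Set (Label × SCIForm)),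
      g 0 = l ∧ k 0 = E ∧ (∀ i < n, Extend (g i) (k i) (g (i + 1)) (k (i + 1))) ∧
      Node.bot ∉ g n ∧ (∀ l' E', ¬ Extend (g n) (k n) l' E') := by
  by_cases hx : ∃ l' E', Extend l E l' E'
  · obtain ⟨_, _, hx⟩ := hx
    obtain ⟨l', E', f', hx', h', hlt⟩ := h.progress hM hV hx
    obtain ⟨n, g, k, hg, hk, hstep, hbot, hfull⟩ := h'.exists_fullyExpanded hM hV E'
    refine ⟨n + 1, fun i => Nat.casesOn i l g, fun i => Nat.casesOn i E k, rfl, rfl, ?_,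
      hbot, hfull⟩
    rintro (_ | i) hi
    · subst hg hk
      exact hx'
    · exact hstep i (by omega)
  · exact ⟨0, fun _ => l, fun _ => E, rfl, rfl, by simp, h.bot,
      fun l' E' hE => hx ⟨l', E', hE⟩⟩
termination_by (pendingSize l E, missingEqs l)
decreasing_by exact hlt

/-- soundness of TC_SCI.  If an SCI-formula φ is SCI-satisfiable,
then φ is tableau-satisfiable (there is an open, fully expanded TC_SCI-tableau
with w⁺ : φ at its root); equivalently, if there is a closed TC_SCI-tableau
with w⁺ : φ at its root, then φ is not SCI-satisfiable. -/
theorem stmt_3 (φ : SCIForm) :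
    (SCISatisfiable φ → ∀ w : Label, posL w → TableauSatFrom w φ) ∧
    (∀ w : Label, posL w → ClosedTab [Node.lf w φ] ∅ → ¬ SCISatisfiable φ) := by
  refine ⟨?_, ?_⟩
  · rintro ⟨U, M, V, hM, hV, hφ⟩ w hw
    exact (Realizes.singleton hw hφ).exists_fullyExpanded hM hV ∅
  · rintro w hw hc ⟨U, M, V, hM, hV, hφ⟩
    exact hc.not_realizes hM hV _ (Realizes.singleton hw hφ)
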